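/- Nerve theorem for strong-good covers of finite spaces: Let X be a finite T0-space and let U = {U_i}_{i∈I} be a family of open subspaces with ⋃_{i∈I} U_i = X. If every intersection of elements of U is empty or collapsible (i.e., U is a strong-good cover of X), then X and the non-Hausdorff nerve χ(N(U)) (the face poset of the nerve N(U), regarded as a finite T0-space) have the same simple homotopy type. -/

import Mathlib

/-! ## Finite T₀-spaces as finite posets with the Alexandrov (down-set) topology -/

universe u v w

/-- The Alexandrov topology on a preorder: the open sets are the down-sets. -/
def alexTop (P : Type u) [Preorder P] : TopologicalSpace P where
  IsOpen s := IsLowerSet s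
  isOpen_univ := isLowerSet_univ
  isOpen_inter _ _ hs ht := hs.inter ht
  isOpen_sUnion _ hS := isLowerSet_sUnion hS

/-- A subset of a poset is contractible if, endowed with the Alexandrov topology of its
induced order, it is a contractible space. -/
def ContractibleSet {P : Type u} [Preorder P] (A : Set P) : Prop :=
  @ContractibleSpace A (alexTop A)

/-- A topological space is homotopically trivial if it is weak homotopy equivalent to a
point: nonempty, path-connected, and all homotopy groups `π_n`, `n ≥ 1`, are trivial at
every basepoint. -/
def HTrivial (T : Type u) [TopologicalSpace T] : Prop :=
  Nonempty T ∧ PathConnectedSpace T ∧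
    ∀ (n : ℕ) (x : T), Subsingleton (HomotopyGroup (Fin (n + 1)) T x)

/-- A subset of a poset is homotopically trivial if, with the Alexandrov topology of its
induced order, it is homotopically trivial as a space. -/
def HTrivialSet {P : Type u} [Preorder P] (A : Set P) : Prop :=
  @HTrivial A (alexTop A)

/-- `Û_x` relative to the subspace `A`: the points of `A` strictly below `x`. -/
def hatDown {P : Type u} [Preorder P] (A : Set P) (x : P) : Set P := {y ∈ A | y < x}

/-- `F̂_x` relative to the subspace `A`: the points of `A` strictly above `x`. -/
def hatUp {P : Type u} [Preorder P] (A : Set P) (x : P) : Set P := {y ∈ A | x < y}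

/-- One elementary collapse of finite spaces: remove from the subspace `A` a weak point,
i.e. a point `x ∈ A` such that `Û_x` or `F̂_x` (computed in `A`) is contractible. -/
def CollapseStep {P : Type u} [Preorder P] (A B : Set P) : Prop :=
  ∃ x ∈ A, (ContractibleSet (hatDown A x) ∨ ContractibleSet (hatUp A x)) ∧ B = A \ {x}

/-- The subspace `A` collapses to the subspace `B` (`A ↘ B`): `B` is obtained from `A` by
successively removing weak points. -/
def CollapsesToSet {P : Type u} [Preorder P] (A B : Set P) : Prop :=
  Relation.ReflTransGen CollapseStep A B

/-- A subspace of a finite space is collapsible if it collapses to a single point. -/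
def CollapsibleSet {P : Type u} [Preorder P] (A : Set P) : Prop :=
  ∃ x : P, CollapsesToSet A ({x} : Set P)

/-- A bundled finite poset, i.e. a finite T₀-space. -/
structure FinPoset : Type (u + 1) where
  carrier : Type u
  [po : PartialOrder carrier]
  [fin : Finite carrier]

attribute [instance] FinPoset.po FinPoset.fin

/-- The finite space `P` collapses to (a subspace order-isomorphic to) the finite
space `Q`. -/
def FinPoset.CollapsesTo (P Q : FinPoset.{u}) : Prop :=
  ∃ A : Set P.carrier, CollapsesToSet (Set.univ : Set P.carrier) A ∧
    Nonempty (Q.carrier ≃o A)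

/-- Two finite T₀-spaces have the same simple homotopy type (`X ⧸↘ Y`) if they are related
by the equivalence relation generated by collapses. -/
def SHE (P Q : FinPoset.{u}) : Prop := Relation.EqvGen FinPoset.CollapsesTo P Q

/-! ## Relations, hulls, relation cylinders -/

/-- The open hull of a subset: `{x : x ≤ a for some a ∈ A}`. -/
def openHull {P : Type u} [Preorder P] (A : Set P) : Set P := {x | ∃ a ∈ A, x ≤ a}

/-- The closure of a subset of a finite space: `{x : x ≥ a for some a ∈ A}`. -/
def cloHull {P : Type u} [Preorder P] (A : Set P) : Set P := {x | ∃ a ∈ A, a ≤ x}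

/-- `R⁻¹(B) = {x : x R y for some y ∈ B}`. -/
def relPre {X : Type u} {Y : Type v} (R : Set (X × Y)) (B : Set Y) : Set X :=
  {x | ∃ y ∈ B, (x, y) ∈ R}

/-- `R(A) = {y : x R y for some x ∈ A}`. -/
def relIm {X : Type u} {Y : Type v} (R : Set (X × Y)) (A : Set X) : Set Y :=
  {y | ∃ x ∈ A, (x, y) ∈ R}

/-- The composite `R₂ ∘ R₁ = {(x,z) : ∃ y, x R₁ y and y R₂ z}`. -/
def relComp {X : Type u} {Y : Type v} {Z : Type w} (R₁ : Set (X × Y)) (R₂ : Set (Y × Z)) :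
    Set (X × Z) :=
  {p | ∃ y : Y, (p.1, y) ∈ R₁ ∧ (y, p.2) ∈ R₂}

/-- The relation cylinder `B(R)` of a relation `R ⊆ X × Z`: the underlying set is the
disjoint union `X ⊔ Z`. -/
def RelCyl (X : Type u) (Z : Type u) [PartialOrder X] [PartialOrder Z]
    (R : Set (X × Z)) : Type u := X ⊕ Z

/-- The order of the relation cylinder: keep the given orders on `X` and `Z`, and set
`x ≤ z` for `x ∈ X`, `z ∈ Z` iff there are `x' ∈ X`, `z' ∈ Z` with `x ≤ x'`, `z' ≤ z` and
`x' R z'`. -/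
def RelCyl.le {X Z : Type u} [PartialOrder X] [PartialOrder Z] (R : Set (X × Z)) :
    X ⊕ Z → X ⊕ Z → Prop
  | .inl x, .inl x' => x ≤ x'
  | .inr z, .inr z' => z ≤ z'
  | .inl x, .inr z => ∃ (x' : X) (z' : Z), x ≤ x' ∧ z' ≤ z ∧ (x', z') ∈ R
  | .inr _, .inl _ => False

instance RelCyl.instPartialOrder {X Z : Type u} [PartialOrder X] [PartialOrder Z]
    (R : Set (X × Z)) : PartialOrder (RelCyl X Z R) where
  le := RelCyl.le R
  le_refl a := by cases a <;> exact _root_.le_refl _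
  le_trans a b c hab hbc := by
    cases a with
    | inl x =>
      cases b with
      | inl x' =>
        cases c with
        | inl x'' => exact _root_.le_trans (α := X) hab hbc
        | inr z =>
          obtain ⟨x1, z1, h1, h2, h3⟩ := hbc
          exact ⟨x1, z1, _root_.le_trans (α := X) hab h1, h2, h3⟩
      | inr z =>
        cases c with
        | inl x'' => exact (hbc : False).elim
        | inr z' =>
          obtain ⟨x1, z1, h1, h2, h3⟩ := hab
          exact ⟨x1, z1, h1, _root_.le_trans (α := Z) h2 hbc, h3⟩
    | inr z =>
      cases b with
      | inl x => exact (hab : False).elim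
      | inr z' =>
        cases c with
        | inl x => exact (hbc : False).elim
        | inr z'' => exact _root_.le_trans (α := Z) hab hbc
  le_antisymm a b hab hba := by
    cases a with
    | inl x =>
      cases b with
      | inl x' => exact congrArg Sum.inl (_root_.le_antisymm (α := X) hab hba)
      | inr z => exact (hba : False).elim
    | inr z =>
      cases b with
      | inl x => exact (hab : False).elim
      | inr z' => exact congrArg Sum.inr (_root_.le_antisymm (α := Z) hab hba)

instance RelCyl.instFinite {X Z : Type u} [PartialOrder X] [PartialOrder Z]
    [Finite X] [Finite Z] (R : Set (X × Z)) : Finite (RelCyl X Z R) :=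
  inferInstanceAs (Finite (X ⊕ Z))

/-! ## Finite abstract simplicial complexes and collapses -/

/-- A set of finite nonempty sets is an abstract simplicial complex if it is closed under
passing to nonempty subsets. -/
def IsComplex {V : Type u} (K : Set (Finset V)) : Prop :=
  ∀ s ∈ K, s.Nonempty ∧ ∀ t : Finset V, t ⊆ s → t.Nonempty → t ∈ K

/-- `s` is a free face of `K` with unique proper coface `t`. -/
def FreeFace {V : Type u} (K : Set (Finset V)) (s t : Finset V) : Prop :=
  s ∈ K ∧ t ∈ K ∧ s ⊂ t ∧ ∀ u ∈ K, s ⊂ u → u = t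

/-- An elementary collapse of simplicial complexes: remove a free face together with the
unique simplex properly containing it. -/
def CxStep {V : Type u} (K L : Set (Finset V)) : Prop :=
  ∃ s t : Finset V, FreeFace K s t ∧ L = K \ {s, t}

/-- `K` collapses to the subcomplex `L`. -/
def CxCollapsesTo {V : Type u} (K L : Set (Finset V)) : Prop :=
  Relation.ReflTransGen CxStep K L

/-- A simplicial complex is collapsible if it collapses to a single vertex. -/
def CxCollapsible {V : Type u} (K : Set (Finset V)) : Prop :=
  ∃ v : V, CxCollapsesTo K {({v} : Finset V)}

/-- A bundled simplicial complex: a vertex type together with a set of faces. -/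
structure SCx : Type (u + 1) where
  V : Type u
  faces : Set (Finset V)

/-- Generators of simple homotopy equivalence of complexes: elementary collapses and
simplicial isomorphisms. -/
inductive SCxRel : SCx.{u} → SCx.{u} → Prop
  | collapse (V : Type u) (K L : Set (Finset V)) : CxStep K L → SCxRel ⟨V, K⟩ ⟨V, L⟩
  | iso (K L : SCx.{u}) (e : K.V ≃ L.V) :
      (∀ s : Finset K.V, s ∈ K.faces ↔ s.map e.toEmbedding ∈ L.faces) → SCxRel K L

/-- Two simplicial complexes are simple homotopy equivalent if they are related by the
equivalence relation generated by elementary collapses (and isomorphism). -/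
def SCxSHE : SCx.{u} → SCx.{u} → Prop := Relation.EqvGen SCxRel

/-- The order complex `K(X)` of a poset: faces are the nonempty finite chains. -/
def orderComplex (X : Type u) [Preorder X] : Set (Finset X) :=
  {s | s.Nonempty ∧ IsChain (· ≤ ·) (↑s : Set X)}

/-- The nerve of a family of complexes (or of sets): faces are the nonempty finite
subsets of the index set whose members have nonempty intersection. -/
def nerveCx {I : Type u} {α : Type v} (L : I → Set α) : Set (Finset I) :=
  {J | J.Nonempty ∧ (⋂ i ∈ J, L i).Nonempty}

instance Finset.instFiniteOfFinite {I : Type u} [Finite I] : Finite (Finset I) :=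
  Finite.of_injective (fun s : Finset I => (s : Set I)) Finset.coe_injective

/-- The non-Hausdorff nerve of a family of subsets: the poset of nonempty finite subsets
of the index set with nonempty intersection, ordered by inclusion. -/
abbrev NHNerve {I : Type u} {α : Type v} (U : I → Set α) : Type u :=
  {J : Finset I // J.Nonempty ∧ (⋂ i ∈ J, U i).Nonempty}

/-! ## Contractibility of finite spaces via beat points -/

section Contractible

open Topology unitInterval

theorem homotopic_of_forall_le {α : Type u} {β : Type v} [TopologicalSpace α]
    [TopologicalSpace β] [Preorder β] [Topology.IsLowerSet β] (f g : C(α, β))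
    (h : ∀ a, f a ≤ g a) : f.Homotopic g := by
  classical
  refine ⟨⟨⟨fun p => if p.1 = 1 then g p.2 else f p.2, ?_⟩, fun x => by simp, fun x => by simp⟩⟩
  refine continuous_def.2 fun s hs => ?_
  have hlow := Topology.IsLowerSet.isOpen_iff_isLowerSet.1 hs
  have hpre : (fun p : I × α => if p.1 = 1 then g p.2 else f p.2) ⁻¹' s =
      (fun p : I × α => g p.2) ⁻¹' s ∪
        ((fun p : I × α => p.1) ⁻¹' {1}ᶜ ∩ (fun p : I × α => f p.2) ⁻¹' s) := by
    ext ⟨t, a⟩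
    have := fun hg : g a ∈ s => hlow (h a) hg
    by_cases ht : t = 1 <;> simp [ht]
    exact this
  rw [hpre]
  exact (hs.preimage (by fun_prop)).union
    ((isOpen_compl_singleton.preimage continuous_fst).inter (hs.preimage (by fun_prop)))

theorem contractibleSpace_of_forall_le {α : Type u} [TopologicalSpace α] [Preorder α]
    [Topology.IsLowerSet α] (f : α → α) (hf : Monotone f) (c : α) (hle : ∀ a, a ≤ f a)
    (hc : ∀ a, c ≤ f a) : ContractibleSpace α := by
  let F : C(α, α) := ⟨f, Topology.IsLowerSet.monotone_iff_continuous.1 hf⟩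
  refine (contractible_iff_id_nullhomotopic α).2 ⟨c, ?_⟩
  exact (homotopic_of_forall_le (ContinuousMap.id α) F hle).trans
    (homotopic_of_forall_le (ContinuousMap.const α c) F hc).symm

theorem ContractibleSpace.of_retract {α : Type u} {β : Type v} [TopologicalSpace α]
    [TopologicalSpace β] [ContractibleSpace α] (i : C(β, α)) (r : C(α, β))
    (h : r.comp i = ContinuousMap.id β) : ContractibleSpace β := by
  refine (contractible_iff_id_nullhomotopic β).2 ?_
  rw [← h]
  simpa using ((id_nullhomotopic α).comp_right r).comp_left i

/-- In a contractible finite space whose identity is isolated among monotone self-maps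
there is only one point. -/
theorem subsingleton_of_contractibleSpace {α : Type u} [TopologicalSpace α] [PartialOrder α]
    [Topology.IsLowerSet α] [Finite α] [ContractibleSpace α]
    (hle : ∀ f : α → α, Monotone f → (∀ a, f a ≤ a) → ∀ a, f a = a)
    (hge : ∀ f : α → α, Monotone f → (∀ a, a ≤ f a) → ∀ a, f a = a) : Subsingleton α := by
  obtain ⟨c, ⟨H⟩⟩ := id_nullhomotopic α
  have hmono (t : I) : Monotone fun a => H (t, a) :=
    Topology.IsLowerSet.monotone_iff_continuous.2 (by fun_prop)
  have hnear (t : I) : ∀ᶠ t' in 𝓝 t, ∀ a, H (t', a) ≤ H (t, a) := by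
    refine Filter.eventually_all.2 fun a => ?_
    have hopen : IsOpen (Set.Iic (H (t, a))) :=
      Topology.IsLowerSet.isOpen_iff_isLowerSet.2 (isLowerSet_Iic _)
    exact (hopen.preimage (f := fun t' => H (t', a)) (by fun_prop)).mem_nhds le_rfl
  have hclopen : IsClopen {t : I | ∀ a, H (t, a) = a} := by
    constructor
    · refine isClosed_iff_frequently.2 fun t ht => ?_
      obtain ⟨t', h₁, h₂⟩ := (ht.and_eventually (hnear t)).exists
      exact hge _ (hmono t) fun a => (h₁ a).symm.le.trans (h₂ a)
    · refine isOpen_iff_mem_nhds.2 fun t ht => ?_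
      filter_upwards [hnear t] with t' ht'
      exact hle _ (hmono t') fun a => (ht' a).trans (ht a).le
  have hone : (1 : I) ∈ {t : I | ∀ a, H (t, a) = a} := by
    rw [hclopen.eq_univ ⟨0, fun a => by simp⟩]
    trivial
  have hconst (a : α) : a = c := by simpa using (hone a).symm
  exact ⟨fun a b => (hconst a).trans (hconst b).symm⟩

/-- A contractible finite space with more than one point has a beat point. -/
theorem exists_beat_point {α : Type u} [TopologicalSpace α] [PartialOrder α]
    [Topology.IsLowerSet α] [Finite α] [ContractibleSpace α] [Nontrivial α] :
    ∃ b : α, (∃ m, IsGreatest (Set.Iio b) m) ∨ ∃ m, IsLeast (Set.Ioi b) m := by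
  by_contra! hno
  refine not_subsingleton α (subsingleton_of_contractibleSpace ?_ ?_)
  · intro f hf hfa a
    induction a using WellFoundedLT.induction with
    | ind a ih =>
      by_contra hne
      refine (hno a).1 (f a) ⟨lt_of_le_of_ne (hfa a) hne, fun b hb => ?_⟩
      rw [← ih b hb]
      exact hf (le_of_lt hb)
  · intro f hf hfa a
    induction a using WellFoundedGT.induction with
    | ind a ih =>
      by_contra hne
      refine (hno a).2 (f a) ⟨lt_of_le_of_ne (hfa a) (Ne.symm hne), fun b hb => ?_⟩
      rw [← ih b hb]
      exact hf (le_of_lt hb)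

theorem alexTop_isLowerSet (P : Type u) [Preorder P] :
    @Topology.IsLowerSet P (alexTop P) _ :=
  let := alexTop P
  ⟨rfl⟩

theorem ContractibleSet.of_forall_le {P : Type u} [Preorder P] {A : Set P} (f : P → P) (c : P)
    (hc : c ∈ A) (hmaps : ∀ a ∈ A, f a ∈ A) (hmono : ∀ a ∈ A, ∀ b ∈ A, a ≤ b → f a ≤ f b)
    (hle : ∀ a ∈ A, a ≤ f a) (hcf : ∀ a ∈ A, c ≤ f a) : ContractibleSet A := by
  let := alexTop A
  have := alexTop_isLowerSet A
  exact contractibleSpace_of_forall_le (fun a => ⟨f a, hmaps a a.2⟩)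
    (fun a b hab => hmono a a.2 b b.2 hab) ⟨c, hc⟩ (fun a => hle a a.2) fun a => hcf a a.2

theorem ContractibleSet.of_isGreatest {P : Type u} [Preorder P] {A : Set P} {m : P}
    (hm : IsGreatest A m) : ContractibleSet A :=
  .of_forall_le (fun _ => m) m hm.1 (fun _ _ => hm.1) (fun _ _ _ _ _ => le_rfl) hm.2
    fun _ _ => le_rfl

theorem ContractibleSet.of_isLeast {P : Type u} [Preorder P] {A : Set P} {m : P}
    (hm : IsLeast A m) : ContractibleSet A :=
  .of_forall_le id m hm.1 (fun _ h => h) (fun _ _ _ _ h => h) (fun _ _ => le_rfl) hm.2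

theorem ContractibleSet.of_retract {P : Type u} {Q : Type v} [Preorder P] [Preorder Q]
    {A : Set P} {B : Set Q} (hA : ContractibleSet A) (i : B → A) (r : A → B) (hi : Monotone i)
    (hr : Monotone r) (h : ∀ b, r (i b) = b) : ContractibleSet B := by
  let := alexTop A
  let := alexTop B
  have := alexTop_isLowerSet A
  have := alexTop_isLowerSet B
  have : ContractibleSpace A := hA
  exact ContractibleSpace.of_retract
    ⟨i, Topology.IsLowerSet.monotone_iff_continuous.1 hi⟩
    ⟨r, Topology.IsLowerSet.monotone_iff_continuous.1 hr⟩ (ContinuousMap.ext h)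

theorem ContractibleSet.nonempty {P : Type u} [Preorder P] {A : Set P}
    (hA : ContractibleSet A) : A.Nonempty := by
  let := alexTop A
  have : ContractibleSpace A := hA
  obtain ⟨c, -⟩ := id_nullhomotopic A
  exact ⟨c, c.2⟩

theorem ContractibleSet.exists_beat_point {P : Type u} [PartialOrder P] [Finite P] {A : Set P}
    (hA : ContractibleSet A) (hnt : A.Nontrivial) :
    ∃ b ∈ A, (∃ m, IsGreatest (hatDown A b) m) ∨ ∃ m, IsLeast (hatUp A b) m := by
  let := alexTop A
  have := alexTop_isLowerSet A
  have : ContractibleSpace A := hA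
  have := hnt.coe_sort
  obtain ⟨b, ⟨m, hm⟩ | ⟨m, hm⟩⟩ := _root_.exists_beat_point (α := A)
  · exact ⟨b, b.2, .inl ⟨m, ⟨m.2, hm.1⟩, fun y hy => @hm.2 ⟨y, hy.1⟩ hy.2⟩⟩
  · exact ⟨b, b.2, .inr ⟨m, ⟨m.2, hm.1⟩, fun y hy => @hm.2 ⟨y, hy.1⟩ hy.2⟩⟩

/-- Removing a beat point keeps a contractible set contractible. -/
theorem ContractibleSet.diff_beat_point {P : Type u} [PartialOrder P] {A : Set P}
    (hA : ContractibleSet A) {b m : P}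
    (hm : IsGreatest (hatDown A b) m ∨ IsLeast (hatUp A b) m) : ContractibleSet (A \ {b}) := by
  classical
  have hmA : m ∈ A \ {b} := by
    rcases hm with hm | hm
    · exact ⟨hm.1.1, hm.1.2.ne⟩
    · exact ⟨hm.1.1, hm.1.2.ne'⟩
  refine hA.of_retract (fun a => ⟨a, a.2.1⟩)
    (fun a => if h : (a : P) = b then ⟨m, hmA⟩ else ⟨a, a.2, h⟩) (fun _ _ h => h) ?_ ?_
  · intro x y hxy
    have hxy' : (x : P) ≤ y := hxy
    by_cases hx : (x : P) = b <;> by_cases hy : (y : P) = b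
    · simp [hx, hy]
    · simp only [hx, hy, dite_true, dite_false]
      have hby : b < y := lt_of_le_of_ne (hx ▸ hxy') (Ne.symm hy)
      rcases hm with hm | hm
      · exact (hm.1.2.trans hby).le
      · exact hm.2 ⟨y.2, hby⟩
    · simp only [hx, hy, dite_true, dite_false]
      have hxb : x < b := lt_of_le_of_ne (hy ▸ hxy') hx
      rcases hm with hm | hm
      · exact hm.2 ⟨x.2, hxb⟩
      · exact (hxb.trans hm.1.2).le
    · simp only [hx, hy, dite_false]
      exact hxy'
  · intro a
    have : (a : P) ≠ b := a.2.2
    simp [this]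

end Contractible

/-! ## Collapses of complexes of chains -/

section Chains

theorem FreeFace.exists_eq_insert {V : Type u} [DecidableEq V] {K : Set (Finset V)}
    (hK : IsComplex K) {s t : Finset V} (h : FreeFace K s t) : ∃ w ∉ s, t = insert w s := by
  obtain ⟨-, ht, hst, hfree⟩ := h
  obtain ⟨w, hwt, hws⟩ := Finset.exists_of_ssubset hst
  refine ⟨w, hws, (hfree _ ((hK t ht).2 _ ?_ ⟨w, by simp⟩) (Finset.ssubset_insert hws)).symm⟩
  exact Finset.insert_subset hwt hst.subset

theorem CxStep.isComplex {V : Type u} {K L : Set (Finset V)} (h : CxStep K L)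
    (hK : IsComplex K) : IsComplex L := by
  obtain ⟨s, t, ⟨-, -, hst, hfree⟩, rfl⟩ := h
  rintro a ⟨haK, ha⟩
  simp only [Set.mem_insert_iff, Set.mem_singleton_iff, not_or] at ha
  refine ⟨(hK a haK).1, fun b hba hb => ⟨(hK a haK).2 b hba hb, ?_⟩⟩
  rintro (rfl | rfl)
  · exact ha.2 (hfree a haK (lt_of_le_of_ne hba (Ne.symm ha.1)))
  · exact ha.2 (hfree a haK (lt_of_lt_of_le hst hba))

/-- If `S` consists of faces without the vertex `w`, and `S` together with the faces
`insert w a`, `a ∈ S`, is closed under passing to cofaces, then all these faces can be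
collapsed away. -/
theorem cxCollapsesTo_diff_insert {V : Type u} [DecidableEq V] [Finite V] (w : V)
    (S K : Set (Finset V)) (hw : ∀ a ∈ S, w ∉ a) (hS : ∀ a ∈ S, a ∈ K)
    (hS' : ∀ a ∈ S, insert w a ∈ K)
    (hup : ∀ a ∈ S, ∀ u ∈ K, a ⊂ u → u ∈ S ∨ ∃ b ∈ S, u = insert w b) :
    CxCollapsesTo K (K \ {u | u ∈ S ∨ ∃ b ∈ S, u = insert w b}) := by
  induction hn : S.ncard generalizing S K with
  | zero =>
    obtain rfl := (Set.ncard_eq_zero S.toFinite).1 hn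
    have hK : K \ {u | u ∈ (∅ : Set (Finset V)) ∨ ∃ b ∈ (∅ : Set (Finset V)), u = insert w b} =
        K := by
      ext
      simp
    rw [hK]
    exact .refl
  | succ n ih =>
    have hne : S.Nonempty := (Set.ncard_pos S.toFinite).1 (by omega)
    obtain ⟨a, ha⟩ := S.toFinite.exists_maximal hne
    have haS := ha.prop
    have hmax : ∀ b ∈ S, a ⊆ b → b = a := fun b hb hab => (ha.eq_of_le hb hab).symm
    have hinj : ∀ b ∈ S, a ⊆ insert w b → b = a := fun b hb hab =>
      hmax b hb ((Finset.subset_insert_iff_of_notMem (hw a haS)).1 hab)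
    have hstep : CxStep K (K \ {a, insert w a}) := by
      refine ⟨a, insert w a, ⟨hS a haS, hS' a haS, Finset.ssubset_insert (hw a haS), ?_⟩, rfl⟩
      intro u hu hau
      rcases hup a haS u hu hau with huS | ⟨b, hb, rfl⟩
      · exact absurd (hmax u huS hau.subset) hau.ne'
      · rw [hinj b hb hau.subset]
    have hcard : (S \ {a}).ncard = n := by
      rw [Set.ncard_sdiff_singleton_of_mem haS, hn]; rfl
    have hrest := ih (S \ {a}) (K \ {a, insert w a}) (fun b hb => hw b hb.1)
      (fun b hb => ⟨hS b hb.1, ?_⟩) (fun b hb => ⟨hS' b hb.1, ?_⟩) ?_ hcard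
    · have heq : (K \ {a, insert w a}) \ {u | u ∈ S \ {a} ∨ ∃ b ∈ S \ {a}, u = insert w b} =
          K \ {u | u ∈ S ∨ ∃ b ∈ S, u = insert w b} := by
        ext u
        constructor
        · rintro ⟨⟨hu, h₁⟩, h₂⟩
          refine ⟨hu, ?_⟩
          rintro (h | ⟨b, hb, rfl⟩)
          · exact h₂ (.inl ⟨h, fun h' => h₁ (.inl h')⟩)
          · exact h₂ (.inr ⟨b, ⟨hb, fun h' => h₁ (.inr (by rw [Set.mem_singleton_iff.1 h']; rfl))⟩,
              rfl⟩)
        · rintro ⟨hu, h₁⟩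
          refine ⟨⟨hu, ?_⟩, ?_⟩
          · rintro (rfl | rfl)
            · exact h₁ (.inl haS)
            · exact h₁ (.inr ⟨a, haS, rfl⟩)
          · rintro (h | ⟨b, hb, rfl⟩)
            · exact h₁ (.inl h.1)
            · exact h₁ (.inr ⟨b, hb.1, rfl⟩)
      rw [← heq]
      exact .head hstep hrest
    · rintro (rfl | rfl)
      · exact hb.2 rfl
      · exact hw _ hb.1 (Finset.mem_insert_self _ _)
    · rintro (h | h)
      · exact hw a haS (h ▸ Finset.mem_insert_self _ _)
      · exact hb.2 (hinj b hb.1 (h ▸ Finset.subset_insert _ _))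
    · rintro b hb u ⟨hu, hu'⟩ hbu
      simp only [Set.mem_insert_iff, Set.mem_singleton_iff, not_or] at hu'
      rcases hup b hb.1 u hu hbu with h | ⟨c, hc, rfl⟩
      · exact .inl ⟨h, hu'.1⟩
      · exact .inr ⟨c, ⟨hc, fun h => hu'.2 (by rw [Set.mem_singleton_iff.1 h])⟩, rfl⟩

/-- The nonempty finite chains contained in `A`: the order complex of the subspace `A`. -/
def chainsIn {P : Type u} [Preorder P] (A : Set P) : Set (Finset P) :=
  {s | s.Nonempty ∧ IsChain (· ≤ ·) (s : Set P) ∧ (s : Set P) ⊆ A}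

theorem isComplex_chainsIn {P : Type u} [Preorder P] (A : Set P) : IsComplex (chainsIn A) :=
  fun _ hs => ⟨hs.1, fun _ hts ht => ⟨ht, hs.2.1.mono (by exact_mod_cast hts),
    (Finset.coe_subset.2 hts).trans hs.2.2⟩⟩

theorem chainsIn_singleton {P : Type u} [Preorder P] (v : P) : chainsIn {v} = {{v}} := by
  ext s
  simp only [chainsIn, Set.mem_ofPred_eq, Set.mem_singleton_iff]
  constructor
  · rintro ⟨hne, -, hs⟩
    exact (Finset.subset_singleton_iff'.2 fun x hx => hs hx).antisymm
      (Finset.singleton_subset_iff.2 (by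
        obtain ⟨x, hx⟩ := hne
        exact Set.mem_singleton_iff.1 (hs hx) ▸ hx))
  · rintro rfl
    simp

open Classical in
/-- The chains in `A` which either avoid `x` or meet `D` in a member of `M`. -/
def chainsThrough {P : Type u} [Preorder P] (A D : Set P) (x : P) (M : Set (Finset P)) :
    Set (Finset P) :=
  {e ∈ chainsIn A | x ∈ e → e.filter (· ∈ D) ∈ M}

open Classical in
/-- The part in `D` of any chain of `A` through `x` can be replaced by any other chain
in `D`. -/
def IsJoinFactor {P : Type u} [Preorder P] (A D : Set P) (x : P) : Prop :=
  x ∉ D ∧ ∀ e ∈ chainsIn A, x ∈ e → ∀ d : Finset P, IsChain (· ≤ ·) (d : Set P) →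
    (d : Set P) ⊆ D → e.filter (· ∉ D) ∪ d ∈ chainsIn A

open Classical in
theorem IsJoinFactor.chainsThrough_collapse {P : Type u} [Preorder P] [Finite P]
    {A D : Set P} {x : P} (hD : IsJoinFactor A D x) {M : Set (Finset P)} {s : Finset P} {w : P}
    (hws : w ∉ s) (hs : s ∈ M) (ht : insert w s ∈ M)
    (hchain : IsChain (· ≤ ·) (↑(insert w s) : Set P)) (hsub : (↑(insert w s) : Set P) ⊆ D)
    (hfree : ∀ u ∈ M, s ⊂ u → u = insert w s) :
    CxCollapsesTo (chainsThrough A D x M) (chainsThrough A D x (M \ {s, insert w s})) := by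
  obtain ⟨hxD, hjoin⟩ := hD
  have hwD : w ∈ D := hsub (by simp)
  have hxw : x ≠ w := fun h => hxD (h ▸ hwD)
  set S : Set (Finset P) := {e ∈ chainsIn A | x ∈ e ∧ e.filter (· ∈ D) = s}
  have hwS : ∀ e ∈ S, w ∉ e := fun e he hwe =>
    hws (he.2.2 ▸ Finset.mem_filter.2 ⟨hwe, hwD⟩)
  have hfilter : ∀ e ∈ S, (insert w e).filter (· ∈ D) = insert w s := fun e he => by
    rw [Finset.filter_insert, if_pos hwD, he.2.2]
  have hins : ∀ e ∈ S, insert w e ∈ chainsIn A := fun e he => by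
    have h := hjoin e he.1 he.2.1 _ hchain hsub
    convert h using 1
    rw [← he.2.2]
    ext y
    by_cases hy : y ∈ D <;> simp [hy]
  have hpart : ∀ u ∈ chainsIn A, x ∈ u → u.filter (· ∈ D) = insert w s →
      ∃ b ∈ S, u = insert w b := fun u hu hxu hus => by
    have hwu : w ∈ u := (Finset.mem_filter.1 (hus ▸ Finset.mem_insert_self w s)).1
    refine ⟨u.erase w, ⟨(isComplex_chainsIn A u hu).2 _ (Finset.erase_subset _ _)
      ⟨x, Finset.mem_erase.2 ⟨hxw, hxu⟩⟩, Finset.mem_erase.2 ⟨hxw, hxu⟩, ?_⟩,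
      (Finset.insert_erase hwu).symm⟩
    rw [Finset.filter_erase, hus, Finset.erase_insert hws]
  have hcol := cxCollapsesTo_diff_insert w S (chainsThrough A D x M) hwS
    (fun e he => ⟨he.1, fun _ => he.2.2 ▸ hs⟩)
    (fun e he => ⟨hins e he, fun _ => (hfilter e he).symm ▸ ht⟩) ?_
  · convert hcol using 1
    ext u
    constructor
    · rintro ⟨hu, hM⟩
      refine ⟨⟨hu, fun hx => (hM hx).1⟩, ?_⟩
      rintro (h | ⟨b, hb, rfl⟩)
      · exact (hM h.2.1).2 (.inl h.2.2)
      · exact (hM (Finset.mem_insert_of_mem hb.2.1)).2 (.inr (hfilter b hb))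
    · rintro ⟨⟨hu, hM⟩, hR⟩
      refine ⟨hu, fun hx => ⟨hM hx, ?_⟩⟩
      rintro (h | h)
      · exact hR (.inl ⟨hu, hx, h⟩)
      · exact hR (.inr (hpart u hu hx h))
  · rintro e he u ⟨hu, hM⟩ heu
    have hxu : x ∈ u := heu.subset he.2.1
    have hsu : s ⊆ u.filter (· ∈ D) := he.2.2 ▸ Finset.filter_subset_filter _ heu.subset
    rcases hsu.eq_or_ssubset with h | h
    · exact .inl ⟨hu, hxu, h.symm⟩
    · exact .inr (hpart u hu hxu (hfree _ (hM hxu) h))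

/-- If one factor `D` of the link of `x` in the order complex of `A` is collapsible, then
the order complex of `A` collapses to that of `A \ {x}`. -/
theorem IsJoinFactor.chainsIn_collapse {P : Type u} [Preorder P] [Finite P]
    {A D : Set P} {x : P} (hD : IsJoinFactor A D x) (hcol : CxCollapsible (chainsIn D)) :
    CxCollapsesTo (chainsIn A) (chainsIn (A \ {x})) := by
  classical
  obtain ⟨v, hv⟩ := hcol
  have key : ∀ L, CxCollapsesTo (chainsIn D) L → IsComplex L ∧ L ⊆ chainsIn D ∧
      CxCollapsesTo (chainsIn A) (chainsThrough A D x (insert ∅ L)) := by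
    intro L hL
    induction hL with
    | refl =>
      refine ⟨isComplex_chainsIn D, subset_rfl, ?_⟩
      suffices h : chainsThrough A D x (insert ∅ (chainsIn D)) = chainsIn A by
        rw [h]
        exact .refl
      ext e
      refine ⟨fun h => h.1, fun h => ⟨h, fun _ => ?_⟩⟩
      rcases Finset.eq_empty_or_nonempty (e.filter (· ∈ D)) with h' | h'
      · exact .inl h'
      · refine .inr ⟨h', h.2.1.mono ?_, fun y hy => (Finset.mem_filter.1 hy).2⟩
        exact_mod_cast Finset.filter_subset _ _
    | tail _ hstep ih =>
      obtain ⟨hcx, hsub, hA⟩ := ih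
      have hcx' := hstep.isComplex hcx
      obtain ⟨s, t, hst, rfl⟩ := hstep
      obtain ⟨w, hws, rfl⟩ := hst.exists_eq_insert hcx
      refine ⟨hcx', Set.sdiff_subset.trans hsub, hA.trans ?_⟩
      have hs0 : s ≠ ∅ := (hcx s hst.1).1.ne_empty
      have h := hD.chainsThrough_collapse hws (Set.mem_insert_of_mem ∅ hst.1)
        (Set.mem_insert_of_mem ∅ hst.2.1) (hsub hst.2.1).2.1 (hsub hst.2.1).2.2 ?_
      · rw [Set.insert_sdiff_of_notMem] at h
        · exact h
        rintro (h | h)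
        · exact hs0 h.symm
        · exact (Finset.insert_ne_empty w s) h.symm
      · rintro u (rfl | hu) hsu
        · exact absurd hsu (Finset.not_ssubset_empty s)
        · exact hst.2.2.2 u hu hsu
  obtain ⟨-, hvD, hA⟩ := key _ hv
  refine hA.trans ?_
  have hv' := hvD (Set.mem_singleton _)
  have h := hD.chainsThrough_collapse (M := {∅, {v}}) (Finset.notMem_empty v) (by simp) (by simp)
    (by simp) (by simpa using hv'.2.2) (by
      rintro u (rfl | rfl) hu
      · exact absurd hu (Finset.not_ssubset_empty _)
      · rfl)
  suffices heq : chainsThrough A D x ({∅, {v}} \ {∅, insert v ∅}) = chainsIn (A \ {x}) by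
    rwa [heq] at h
  ext e
  simp only [chainsThrough, chainsIn, insert_empty_eq, Set.sdiff_self, Set.mem_empty_iff_false,
    Set.mem_ofPred_eq, Set.subset_sdiff, Set.disjoint_singleton_right, Finset.mem_coe]
  tauto

theorem isJoinFactor_hatDown {P : Type u} [PartialOrder P] (A : Set P) (x : P) :
    IsJoinFactor A (hatDown A x) x := by
  classical
  refine ⟨fun h => lt_irrefl x h.2, fun e he hx d hd hdD => ⟨⟨x, ?_⟩, ?_, ?_⟩⟩
  · exact Finset.mem_union_left _ (Finset.mem_filter.2 ⟨hx, fun h => lt_irrefl x h.2⟩)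
  · have hup : ∀ y ∈ e.filter (· ∉ hatDown A x), x ≤ y := fun y hy => by
      obtain ⟨hye, hyD⟩ := Finset.mem_filter.1 hy
      rcases he.2.1.total hye hx with h | h
      · rcases h.eq_or_lt with rfl | h
        · exact le_rfl
        · exact absurd ⟨he.2.2 hye, h⟩ hyD
      · exact h
    rw [Finset.coe_union, IsChain, Set.pairwise_union]
    refine ⟨he.2.1.mono (by exact_mod_cast Finset.filter_subset _ _), hd, fun a ha b hb _ => ?_⟩
    have hba : b ≤ a := (hdD hb).2.le.trans (hup a ha)
    exact ⟨.inr hba, .inl hba⟩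
  · rw [Finset.coe_union]
    refine Set.union_subset (fun y hy => he.2.2 (Finset.mem_filter.1 hy).1) fun y hy => (hdD hy).1

theorem isJoinFactor_hatUp {P : Type u} [PartialOrder P] (A : Set P) (x : P) :
    IsJoinFactor A (hatUp A x) x := by
  classical
  refine ⟨fun h => lt_irrefl x h.2, fun e he hx d hd hdD => ⟨⟨x, ?_⟩, ?_, ?_⟩⟩
  · exact Finset.mem_union_left _ (Finset.mem_filter.2 ⟨hx, fun h => lt_irrefl x h.2⟩)
  · have hdown : ∀ y ∈ e.filter (· ∉ hatUp A x), y ≤ x := fun y hy => by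
      obtain ⟨hye, hyD⟩ := Finset.mem_filter.1 hy
      rcases he.2.1.total hx hye with h | h
      · rcases h.eq_or_lt with rfl | h
        · exact le_rfl
        · exact absurd ⟨he.2.2 hye, h⟩ hyD
      · exact h
    rw [Finset.coe_union, IsChain, Set.pairwise_union]
    refine ⟨he.2.1.mono (by exact_mod_cast Finset.filter_subset _ _), hd, fun a ha b hb _ => ?_⟩
    have hab : a ≤ b := (hdown a ha).trans (hdD hb).2.le
    exact ⟨.inl hab, .inr hab⟩
  · rw [Finset.coe_union]
    refine Set.union_subset (fun y hy => he.2.2 (Finset.mem_filter.1 hy).1) fun y hy => (hdD hy).1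

/-- The order complex of a cone is collapsible. -/
theorem cxCollapsible_chainsIn_of_cone {P : Type u} [PartialOrder P] [Finite P] {D : Set P}
    {m : P} (hm : m ∈ D) (hcone : ∀ d ∈ D, d ≤ m ∨ m ≤ d) : CxCollapsible (chainsIn D) := by
  classical
  refine ⟨m, ?_⟩
  have herase : ∀ u ∈ chainsIn D, m ∈ u → (u.erase m).Nonempty →
      ∃ b ∈ {e ∈ chainsIn D | m ∉ e}, u = insert m b := fun u hu hmu hne =>
    ⟨u.erase m, ⟨(isComplex_chainsIn D u hu).2 _ (Finset.erase_subset _ _) hne,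
      Finset.notMem_erase _ _⟩, (Finset.insert_erase hmu).symm⟩
  have h := cxCollapsesTo_diff_insert m {e ∈ chainsIn D | m ∉ e} (chainsIn D)
    (fun e he => he.2) (fun e he => he.1) ?_ ?_
  · convert h using 1
    ext u
    constructor
    · rintro rfl
      refine ⟨⟨by simp, by simp, by simpa using hm⟩, ?_⟩
      rintro (h | ⟨b, hb, h⟩)
      · exact h.2 (Finset.mem_singleton_self m)
      · obtain ⟨y, hy⟩ := hb.1.1
        have hym : y ∈ ({m} : Finset P) := h ▸ Finset.mem_insert_of_mem hy
        exact hb.2 (Finset.mem_singleton.1 hym ▸ hy)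
    · rintro ⟨hu, hR⟩
      have hmu : m ∈ u := by
        by_contra hmu
        exact hR (.inl ⟨hu, hmu⟩)
      by_contra hne
      refine hR (.inr (herase u hu hmu ?_))
      rw [Finset.nonempty_iff_ne_empty, Ne, Finset.erase_eq_empty_iff]
      rintro (rfl | rfl)
      · exact absurd hmu (Finset.notMem_empty m)
      · exact hne rfl
  · intro e he
    refine ⟨⟨m, Finset.mem_insert_self _ _⟩, ?_, ?_⟩
    · rw [Finset.coe_insert]
      exact he.1.2.1.insert fun b hb _ => (hcone b (he.1.2.2 hb)).symm
    · rw [Finset.coe_insert]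
      exact Set.insert_subset hm he.1.2.2
  · intro e he u hu heu
    by_cases hmu : m ∈ u
    · refine .inr (herase u hu hmu (he.1.1.mono ?_))
      exact Finset.subset_erase.2 ⟨heu.subset, he.2⟩
    · exact .inl ⟨hu, hmu⟩

theorem CxCollapsible.of_collapsesTo {V : Type u} {K L : Set (Finset V)}
    (h : CxCollapsesTo K L) (hL : CxCollapsible L) : CxCollapsible K :=
  hL.imp fun _ hv => h.trans hv

/-- The order complex of a contractible finite space is collapsible. -/
theorem ContractibleSet.cxCollapsible {P : Type u} [PartialOrder P] [Finite P] {A : Set P}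
    (hA : ContractibleSet A) : CxCollapsible (chainsIn A) := by
  induction hn : A.ncard using Nat.strong_induction_on generalizing A with
  | _ n ih =>
    rcases A.subsingleton_or_nontrivial with hs | hnt
    · obtain ⟨v, rfl⟩ := hs.eq_empty_or_singleton.resolve_left hA.nonempty.ne_empty
      exact ⟨v, chainsIn_singleton v ▸ .refl⟩
    · obtain ⟨b, hb, h⟩ := hA.exists_beat_point hnt
      have hlt : (A \ {b}).ncard < n :=
        hn ▸ Set.ncard_sdiff_singleton_lt_of_mem hb A.toFinite
      rcases h with ⟨m, hm⟩ | ⟨m, hm⟩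
      · exact .of_collapsesTo ((isJoinFactor_hatDown A b).chainsIn_collapse
          (cxCollapsible_chainsIn_of_cone hm.1 fun d hd => .inl (hm.2 hd)))
          (ih _ hlt (hA.diff_beat_point (.inl hm)) rfl)
      · exact .of_collapsesTo ((isJoinFactor_hatUp A b).chainsIn_collapse
          (cxCollapsible_chainsIn_of_cone hm.1 fun d hd => .inr (hm.2 hd)))
          (ih _ hlt (hA.diff_beat_point (.inr hm)) rfl)

theorem CollapsesToSet.chainsIn {P : Type u} [PartialOrder P] [Finite P] {A B : Set P}
    (h : CollapsesToSet A B) : CxCollapsesTo (chainsIn A) (chainsIn B) := by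
  induction h with
  | refl => exact .refl
  | tail _ hstep ih =>
    obtain ⟨x, -, hx | hx, rfl⟩ := hstep
    · exact ih.trans ((isJoinFactor_hatDown _ x).chainsIn_collapse hx.cxCollapsible)
    · exact ih.trans ((isJoinFactor_hatUp _ x).chainsIn_collapse hx.cxCollapsible)

theorem CollapsibleSet.cxCollapsible {P : Type u} [PartialOrder P] [Finite P] {A : Set P}
    (h : CollapsibleSet A) : CxCollapsible (_root_.chainsIn A) :=
  h.imp fun x hx => chainsIn_singleton x ▸ hx.chainsIn

/-- An elementary collapse of complexes induces a collapse of face posets. -/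
theorem CxStep.collapsesToSet {V : Type u} {K L : Set (Finset V)} (h : CxStep K L)
    (hK : IsComplex K) : CollapsesToSet K L := by
  classical
  obtain ⟨s, t, hst, rfl⟩ := h
  obtain ⟨w, hws, rfl⟩ := hst.exists_eq_insert hK
  obtain ⟨hs, ht, hlt, hfree⟩ := hst
  have hup : hatUp K s = {insert w s} := by
    ext u
    exact ⟨fun hu => hfree u hu.1 hu.2, by rintro rfl; exact ⟨ht, hlt⟩⟩
  have h₁ : CollapseStep K (K \ {s}) :=
    ⟨s, hs, .inr (hup ▸ .of_isLeast isLeast_singleton), rfl⟩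
  have hws' : ({w} : Finset V) ≠ s := by
    rintro rfl
    exact hws (Finset.mem_singleton_self w)
  have hne := (hK s hs).1
  have hmem : ∀ c ∈ hatDown (K \ {s}) (insert w s),
      insert w c ∈ hatDown (K \ {s}) (insert w s) := by
    rintro c ⟨⟨hc, hcs⟩, hclt⟩
    have hsub : insert w c ⊆ insert w s :=
      Finset.insert_subset (Finset.mem_insert_self _ _) hclt.le
    refine ⟨⟨(hK _ ht).2 _ hsub ⟨w, Finset.mem_insert_self _ _⟩, ?_⟩, lt_of_le_of_ne hsub ?_⟩
    · rintro rfl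
      exact hws (Finset.mem_insert_self _ _)
    · intro heq
      have hsc : s ⊆ c := (Finset.subset_insert_iff_of_notMem hws).1
        ((Finset.subset_insert w s).trans heq.ge)
      exact hclt.ne (hfree c hc (lt_of_le_of_ne hsc (Ne.symm hcs)))
  have h₂ : CollapseStep (K \ {s}) ((K \ {s}) \ {insert w s}) := by
    refine ⟨insert w s, ⟨ht, hlt.ne'⟩, .inl ?_, rfl⟩
    refine .of_forall_le (insert w) {w} ⟨⟨(hK _ ht).2 _ (by simp) (by simp), hws'⟩, ?_⟩ hmem
      (fun a _ b _ hab => Finset.insert_subset_insert w hab)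
      (fun a _ => Finset.subset_insert w a) (fun a _ => by simp)
    refine lt_of_le_of_ne (by simp) fun heq => ?_
    obtain ⟨y, hy⟩ := hne
    have : y ∈ ({w} : Finset V) := heq ▸ Finset.mem_insert_of_mem hy
    exact hws (Finset.mem_singleton.1 this ▸ hy)
  have heq : K \ {s, insert w s} = (K \ {s}) \ {insert w s} := by
    rw [Set.sdiff_sdiff, Set.singleton_union]
  rw [heq]
  exact .tail (.single h₁) h₂

theorem CxCollapsesTo.collapsesToSet {V : Type u} {K L : Set (Finset V)}
    (h : CxCollapsesTo K L) (hK : IsComplex K) : CollapsesToSet K L := by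
  suffices IsComplex L ∧ CollapsesToSet K L from this.2
  induction h with
  | refl => exact ⟨hK, .refl⟩
  | tail _ hstep ih => exact ⟨hstep.isComplex ih.1, ih.2.trans (hstep.collapsesToSet ih.1)⟩

end Chains

/-! ## Simple homotopy type -/

section SimpleHomotopy

theorem SHE.symm {P Q : FinPoset.{u}} (h : SHE P Q) : SHE Q P := Relation.EqvGen.symm _ _ h

theorem SHE.trans {P Q R : FinPoset.{u}} (h : SHE P Q) (h' : SHE Q R) : SHE P R :=
  Relation.EqvGen.trans _ _ _ h h'

theorem CollapsesToSet.she_of_orderIso {P Q : Type u} [PartialOrder P] [Finite P]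
    [PartialOrder Q] [Finite Q] {A : Set P} (h : CollapsesToSet Set.univ A) (e : Q ≃o A) :
    SHE (FinPoset.mk P) (FinPoset.mk Q) :=
  .rel _ _ ⟨A, h, ⟨e⟩⟩

theorem OrderIso.she {P Q : Type u} [PartialOrder P] [Finite P] [PartialOrder Q] [Finite Q]
    (e : P ≃o Q) : SHE (FinPoset.mk P) (FinPoset.mk Q) :=
  CollapsesToSet.she_of_orderIso .refl (e.symm.trans OrderIso.Set.univ.symm)

theorem CollapseStep.she {P : Type u} [PartialOrder P] [Finite P] {A B : Set P}
    (h : CollapseStep A B) : SHE (FinPoset.mk A) (FinPoset.mk B) := by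
  obtain ⟨x, hx, hweak, rfl⟩ := h
  have hstep : CollapseStep (Set.univ : Set A) (Set.univ \ {⟨x, hx⟩}) := by
    refine ⟨⟨x, hx⟩, trivial, hweak.imp (fun h => ?_) (fun h => ?_), rfl⟩
    · exact h.of_retract (fun y => ⟨y.1.1, y.1.2, y.2.2⟩)
        (fun y => ⟨⟨y.1, y.2.1⟩, trivial, y.2.2⟩) (fun _ _ h => h) (fun _ _ h => h) fun _ => rfl
    · exact h.of_retract (fun y => ⟨y.1.1, y.1.2, y.2.2⟩)
        (fun y => ⟨⟨y.1, y.2.1⟩, trivial, y.2.2⟩) (fun _ _ h => h) (fun _ _ h => h) fun _ => rfl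
  refine CollapsesToSet.she_of_orderIso (.single hstep) ?_
  exact
    { toFun := fun y => ⟨⟨y.1, y.2.1⟩, trivial, fun h => y.2.2 (congrArg Subtype.val h)⟩
      invFun := fun y => ⟨y.1.1, y.1.2, fun h => y.2.2 (Subtype.ext h)⟩
      left_inv := fun _ => rfl
      right_inv := fun _ => rfl
      map_rel_iff' := Iff.rfl }

theorem CollapsesToSet.she {P : Type u} [PartialOrder P] [Finite P] {A B : Set P}
    (h : CollapsesToSet A B) : SHE (FinPoset.mk A) (FinPoset.mk B) := by
  induction h with
  | refl => exact .refl _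
  | tail _ hstep ih => exact ih.trans hstep.she

theorem ContractibleSet.image {P : Type u} {Q : Type v} [Preorder P] [Preorder Q] (e : P ↪o Q)
    {A : Set P} (hA : ContractibleSet A) : ContractibleSet (e '' A) := by
  have hmem (y : e '' A) : ∃ a : A, e a = y := by
    obtain ⟨_, a, ha, rfl⟩ := y
    exact ⟨⟨a, ha⟩, rfl⟩
  choose i hi using hmem
  refine hA.of_retract i (fun a => ⟨e a, a, a.2, rfl⟩) (fun x y hxy => ?_)
    (fun _ _ h => e.monotone h) fun y => Subtype.ext (hi y)
  exact e.le_iff_le.1 (by rw [hi, hi]; exact hxy)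

theorem CollapsesToSet.image {P : Type u} {Q : Type v} [PartialOrder P] [PartialOrder Q]
    (e : P ↪o Q) {A B : Set P} (h : CollapsesToSet A B) :
    CollapsesToSet (e '' A) (e '' B) := by
  induction h with
  | refl => exact .refl
  | @tail A _ _ hstep ih => ?_
  obtain ⟨x, hx, hweak, rfl⟩ := hstep
  have hdown : hatDown (e '' A) (e x) = e '' hatDown A x := by
    ext y
    constructor
    · rintro ⟨⟨a, ha, rfl⟩, h⟩
      exact ⟨a, ⟨ha, e.lt_iff_lt.1 h⟩, rfl⟩
    · rintro ⟨a, ha, rfl⟩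
      exact ⟨⟨a, ha.1, rfl⟩, e.lt_iff_lt.2 ha.2⟩
  have hup : hatUp (e '' A) (e x) = e '' hatUp A x := by
    ext y
    constructor
    · rintro ⟨⟨a, ha, rfl⟩, h⟩
      exact ⟨a, ⟨ha, e.lt_iff_lt.1 h⟩, rfl⟩
    · rintro ⟨a, ha, rfl⟩
      exact ⟨⟨a, ha.1, rfl⟩, e.lt_iff_lt.2 ha.2⟩
  refine ih.tail ⟨e x, ⟨x, hx, rfl⟩, ?_, ?_⟩
  · rw [hdown, hup]
    exact hweak.imp (fun h => h.image e) fun h => h.image e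
  · rw [Set.image_sdiff e.injective, Set.image_singleton]

theorem CollapsibleSet.image {P : Type u} {Q : Type v} [PartialOrder P] [PartialOrder Q]
    (e : P ↪o Q) {A : Set P} (h : CollapsibleSet A) : CollapsibleSet (e '' A) := by
  obtain ⟨x, hx⟩ := h
  exact ⟨e x, by simpa using hx.image e⟩

/-- Remove the points outside `Z` one at a time, in an order refining `r`. -/
theorem rel_univ_of_forall_remove {P : Type u} [Finite P] (r : P → P → Prop) [IsTrans P r]
    [Std.Irrefl r] (T : Set P → Set P → Prop) (hrefl : ∀ A, T A A)
    (htrans : ∀ A B C, T A B → T B C → T A C) (Z : Set P)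
    (h : ∀ A, Z ⊆ A → ∀ x ∈ A \ Z, (∀ y ∈ A, r y x → y ∈ Z) → T A (A \ {x})) :
    T Set.univ Z := by
  suffices ∀ A, Z ⊆ A → T A Z from this _ (Set.subset_univ Z)
  intro A
  induction hn : A.ncard using Nat.strong_induction_on generalizing A with
  | _ n ih =>
    intro hZA
    rcases (A \ Z).eq_empty_or_nonempty with he | hne
    · rw [hZA.antisymm (Set.sdiff_eq_empty.1 he)]
      exact hrefl A
    · obtain ⟨x, hx, hmin⟩ := (Finite.wellFounded_of_trans_of_irrefl r).has_min _ hne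
      refine htrans _ _ _ (h A hZA x hx fun y hy hyx => ?_) (ih _
        (hn ▸ Set.ncard_sdiff_singleton_lt_of_mem hx.1 A.toFinite) _ rfl fun z hz =>
          ⟨hZA hz, fun h => hx.2 (Set.mem_singleton_iff.1 h ▸ hz)⟩)
      by_contra hyZ
      exact hmin y ⟨hy, hyZ⟩ hyx

end SimpleHomotopy

/-! ## Collapses of relation cylinders -/

namespace RelCyl

variable {X Z : Type u} [PartialOrder X] [PartialOrder Z] (R : Set (X × Z))

/-- The inclusion of the first factor into the relation cylinder. -/
def inlEmb : X ↪o RelCyl X Z R where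
  toFun := Sum.inl
  inj' := Sum.inl_injective
  map_rel_iff' := Iff.rfl

/-- The inclusion of the second factor into the relation cylinder. -/
def inrEmb : Z ↪o RelCyl X Z R where
  toFun := Sum.inr
  inj' := Sum.inr_injective
  map_rel_iff' := Iff.rfl

variable {R}

theorem eq_inl_or_inr (y : RelCyl X Z R) : (∃ x, y = inlEmb R x) ∨ ∃ z, y = inrEmb R z := by
  rcases y with x | z
  · exact .inl ⟨x, rfl⟩
  · exact .inr ⟨z, rfl⟩

theorem inlEmb_ne_inrEmb (x : X) (z : Z) : inlEmb R x ≠ inrEmb R z := Sum.inl_ne_inr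

theorem not_inrEmb_lt_inlEmb (x : X) (z : Z) : ¬ inrEmb R z < inlEmb R x := fun h => h.le

theorem inlEmb_lt_inrEmb_iff
    (hR : ∀ x x' z z', x ≤ x' → z' ≤ z → (x', z') ∈ R → (x, z) ∈ R) (x : X) (z : Z) :
    inlEmb R x < inrEmb R z ↔ (x, z) ∈ R := by
  constructor
  · intro h
    obtain ⟨x', z', h₁, h₂, h₃⟩ : ∃ (x' : X) (z' : Z), x ≤ x' ∧ z' ≤ z ∧ (x', z') ∈ R := h.le
    exact hR _ _ _ _ h₁ h₂ h₃
  · intro h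
    refine lt_of_le_of_ne ?_ (inlEmb_ne_inrEmb x z)
    exact (⟨x, z, le_rfl, le_rfl, h⟩ : ∃ (x' : X) (z' : Z), x ≤ x' ∧ z' ≤ z ∧ (x', z') ∈ R)

variable [Finite X] [Finite Z]

/-- If the points related to each `x` have a least element, the relation cylinder has the
simple homotopy type of its second factor. -/
theorem she_right (hR : ∀ x x' z z', x ≤ x' → z' ≤ z → (x', z') ∈ R → (x, z) ∈ R)
    (hleast : ∀ x, ∃ m, IsLeast {z | (x, z) ∈ R} m) :
    SHE (FinPoset.mk (RelCyl X Z R)) (FinPoset.mk Z) := by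
  refine CollapsesToSet.she_of_orderIso (A := Set.range (inrEmb R)) ?_ (inrEmb R).orderIso
  refine rel_univ_of_forall_remove (· > ·) CollapsesToSet (fun _ => .refl)
    (fun _ _ _ => .trans) _ fun A hA y hy hup => ?_
  obtain ⟨x, rfl⟩ | ⟨z, rfl⟩ := eq_inl_or_inr y
  · obtain ⟨m, hm, hmin⟩ := hleast x
    refine .single ⟨_, hy.1, .inr (.of_isLeast (m := inrEmb R m) ⟨⟨hA ⟨m, rfl⟩, ?_⟩, ?_⟩), rfl⟩
    · exact (inlEmb_lt_inrEmb_iff hR x m).2 hm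
    · rintro y ⟨hyA, hxy⟩
      obtain ⟨z, rfl⟩ := hup y hyA hxy
      exact (inrEmb R).monotone (hmin ((inlEmb_lt_inrEmb_iff hR x z).1 hxy))
  · exact absurd ⟨z, rfl⟩ hy.2

/-- Remove the points of the second factor of a relation cylinder, smallest points first. -/
theorem rel_univ_range_inlEmb
    (hR : ∀ x x' z z', x ≤ x' → z' ≤ z → (x', z') ∈ R → (x, z) ∈ R)
    (T : Set (RelCyl X Z R) → Set (RelCyl X Z R) → Prop) (hrefl : ∀ A, T A A)
    (htrans : ∀ A B C, T A B → T B C → T A C)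
    (h : ∀ A z, inrEmb R z ∈ A → hatDown A (inrEmb R z) = inlEmb R '' {x | (x, z) ∈ R} →
      T A (A \ {inrEmb R z})) : T Set.univ (Set.range (inlEmb R)) := by
  refine rel_univ_of_forall_remove (· < ·) T hrefl htrans _ fun A hA y hy hdown => ?_
  obtain ⟨x, rfl⟩ | ⟨z, rfl⟩ := eq_inl_or_inr y
  · exact absurd ⟨x, rfl⟩ hy.2
  · refine h A z hy.1 (Set.ext fun y => ⟨?_, ?_⟩)
    · rintro ⟨hyA, hyz⟩
      obtain ⟨x, rfl⟩ := hdown y hyA hyz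
      exact ⟨x, (inlEmb_lt_inrEmb_iff hR x z).1 hyz, rfl⟩
    · rintro ⟨x, hx, rfl⟩
      exact ⟨hA ⟨x, rfl⟩, (inlEmb_lt_inrEmb_iff hR x z).2 hx⟩

theorem she_left_of_contractibleSet
    (hR : ∀ x x' z z', x ≤ x' → z' ≤ z → (x', z') ∈ R → (x, z) ∈ R)
    (hcon : ∀ z, ContractibleSet {x | (x, z) ∈ R}) :
    SHE (FinPoset.mk (RelCyl X Z R)) (FinPoset.mk X) :=
  CollapsesToSet.she_of_orderIso (A := Set.range (inlEmb R))
    (rel_univ_range_inlEmb hR CollapsesToSet (fun _ => .refl) (fun _ _ _ => .trans)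
      fun _ z hz heq => .single ⟨_, hz, .inl (heq ▸ (hcon z).image _), rfl⟩)
    (inlEmb R).orderIso

theorem chainsIn_collapse_left
    (hR : ∀ x x' z z', x ≤ x' → z' ≤ z → (x', z') ∈ R → (x, z) ∈ R)
    (hcol : ∀ z, CollapsibleSet {x | (x, z) ∈ R}) :
    CxCollapsesTo (chainsIn (Set.univ : Set (RelCyl X Z R)))
      (chainsIn (Set.range (inlEmb R))) :=
  rel_univ_range_inlEmb hR (fun A B => CxCollapsesTo (chainsIn A) (chainsIn B))
    (fun _ => .refl) (fun _ _ _ => .trans) fun A _ _ heq =>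
      (isJoinFactor_hatDown A _).chainsIn_collapse (heq ▸ ((hcol _).image _).cxCollapsible)

end RelCyl

section Subdivision

/-- A finite space has the same simple homotopy type as its barycentric subdivision. -/
theorem she_chainsIn {P : Type u} [PartialOrder P] [Finite P] (A : Set P) :
    SHE (FinPoset.mk A) (FinPoset.mk (chainsIn A)) := by
  classical
  set R : Set (chainsIn A × A) := {p | ∀ y ∈ p.1.1, y ≤ p.2}
  have hR : ∀ (c c' : chainsIn A) (a a' : A), c ≤ c' → a' ≤ a → (c', a') ∈ R → (c, a) ∈ R :=
    fun c c' a a' hc ha h y hy => (h y (hc hy)).trans ha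
  refine (RelCyl.she_right hR fun c => ?_).symm.trans
    (RelCyl.she_left_of_contractibleSet hR fun a => ?_)
  · obtain ⟨m, hm⟩ := c.1.exists_maximal c.2.1
    refine ⟨⟨m, c.2.2.2 hm.prop⟩, fun y hy => ?_, fun a ha => ha m hm.prop⟩
    exact (c.2.2.1.total hy hm.prop).elim id fun h => (hm.eq_of_le hy h).ge
  · have hins (c : chainsIn A) (hc : ∀ y ∈ c.1, y ≤ (a : P)) :
        insert (a : P) c.1 ∈ chainsIn A := by
      refine ⟨⟨a, by simp⟩, ?_, ?_⟩
      · rw [Finset.coe_insert]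
        exact c.2.2.1.insert fun b hb _ => .inr (hc b hb)
      · rw [Finset.coe_insert]
        exact Set.insert_subset a.2 c.2.2.2
    let f (c : chainsIn A) : chainsIn A :=
      if hc : ∀ y ∈ c.1, y ≤ (a : P) then ⟨_, hins c hc⟩ else c
    have hf (c : chainsIn A) (hc : c ∈ {c | (c, a) ∈ R}) : (f c).1 = insert (a : P) c.1 :=
      congrArg Subtype.val (dif_pos hc)
    have ha : {(a : P)} ∈ chainsIn A := ⟨by simp, by simp, by simp⟩
    refine .of_forall_le f ⟨{(a : P)}, ha⟩ ?_ ?_ ?_ ?_ ?_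
    · intro y hy
      exact (Finset.mem_singleton.1 hy).le
    · intro c hc y hy
      change y ∈ (f c).1 at hy
      rw [hf c hc] at hy
      rcases Finset.mem_insert.1 hy with rfl | hy
      · exact le_rfl
      · exact hc y hy
    · intro c hc d hd hcd
      rw [← Subtype.coe_le_coe, hf c hc, hf d hd]
      exact Finset.insert_subset_insert _ hcd
    · intro c hc
      rw [← Subtype.coe_le_coe, hf c hc]
      exact Finset.subset_insert _ _
    · intro c hc
      rw [← Subtype.coe_le_coe, hf c hc]
      simp

theorem she_chainsIn_univ (P : Type u) [PartialOrder P] [Finite P] :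
    SHE (FinPoset.mk P) (FinPoset.mk (chainsIn (Set.univ : Set P))) :=
  OrderIso.Set.univ.symm.she.trans (she_chainsIn _)

/-- The chains of the opposite poset are those of the poset. -/
def chainsInUnivDual (P : Type u) [PartialOrder P] :
    chainsIn (Set.univ : Set P) ≃o chainsIn (Set.univ : Set Pᵒᵈ) where
  toFun s := ⟨s.1, s.2.1, s.2.2.1.symm, Set.subset_univ _⟩
  invFun s := ⟨s.1, s.2.1, s.2.2.1.symm, Set.subset_univ _⟩
  left_inv _ := rfl
  right_inv _ := rfl
  map_rel_iff' := Iff.rfl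

/-- A finite space has the same simple homotopy type as its opposite. -/
theorem she_orderDual (P : Type u) [PartialOrder P] [Finite P] :
    SHE (FinPoset.mk P) (FinPoset.mk Pᵒᵈ) :=
  (she_chainsIn_univ P).trans ((chainsInUnivDual P).she.trans (she_chainsIn_univ Pᵒᵈ).symm)

end Subdivision

/-- A relation cylinder in which every point `z` is related to a collapsible subspace has
the simple homotopy type of its first factor. -/
theorem RelCyl.she_left {X Z : Type u} [PartialOrder X] [PartialOrder Z] [Finite X] [Finite Z]
    {R : Set (X × Z)} (hR : ∀ x x' z z', x ≤ x' → z' ≤ z → (x', z') ∈ R → (x, z) ∈ R)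
    (hcol : ∀ z, CollapsibleSet {x | (x, z) ∈ R}) :
    SHE (FinPoset.mk (RelCyl X Z R)) (FinPoset.mk X) :=
  (she_chainsIn_univ _).trans
    (((chainsIn_collapse_left hR hcol).collapsesToSet (isComplex_chainsIn _)).she.trans
      ((she_chainsIn _).symm.trans (inlEmb R).orderIso.symm.she))

/-- Nerve theorem for strong-good covers of finite spaces: a finite
T₀-space with a strong-good open cover has the same simple homotopy type as the
non-Hausdorff nerve of the cover. -/
theorem stmt_8 {X I : Type u} [PartialOrder X] [Finite X] [Finite I]
    (U : I → Set X) (hopen : ∀ i, IsLowerSet (U i)) (hcover : (⋃ i, U i) = Set.univ)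
    (hstrong : ∀ J : Finset I, J.Nonempty →
      (⋂ i ∈ J, U i) = ∅ ∨ CollapsibleSet (⋂ i ∈ J, U i)) :
    SHE (FinPoset.mk X) (FinPoset.mk (NHNerve U)) := by
  classical
  set R : Set (X × (NHNerve U)ᵒᵈ) := {p | p.1 ∈ ⋂ i ∈ (OrderDual.ofDual p.2).1, U i}
  have hmem (x : X) (J : (NHNerve U)ᵒᵈ) :
      (x, J) ∈ R ↔ ∀ i ∈ (OrderDual.ofDual J).1, x ∈ U i := Set.mem_iInter₂
  have hR : ∀ (x x' : X) (J J' : (NHNerve U)ᵒᵈ), x ≤ x' → J' ≤ J → (x', J') ∈ R → (x, J) ∈ R := by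
    intro x x' J J' hx hJ h
    exact (hmem x J).2 fun i hi => hopen i hx ((hmem x' J').1 h i (hJ hi))
  refine (RelCyl.she_left hR fun J => ?_).symm.trans
    ((RelCyl.she_right hR fun x => ?_).trans (she_orderDual _).symm)
  · have hJ := (OrderDual.ofDual J).2
    exact (hstrong _ hJ.1).resolve_left hJ.2.ne_empty
  · obtain ⟨i, hi⟩ := Set.mem_iUnion.1 (hcover.ge (Set.mem_univ x))
    have hfin : {i | x ∈ U i}.Finite := Set.toFinite _
    have hx : x ∈ ⋂ i ∈ hfin.toFinset, U i := by simp
    refine ⟨OrderDual.toDual ⟨hfin.toFinset, ⟨i, by simpa using hi⟩, x, hx⟩, hx, ?_⟩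
    intro J hJ j hj
    exact hfin.mem_toFinset.2 ((hmem x J).1 hJ j hj)
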